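/- arXiv:2505.15150 — 4 statements merged into one kernel-verified Lean document; each statement's English description precedes it below -/
import Mathlib

section
/- Let p be a prime, G a finite p-group with commutator subgroup G', and g ∈ G. Then (1/|G'|) · ∑_{V ≤ G, V ⊔ G' = G} |V ∩ gG'| · μ(V, G) = 1, where the sum ranges over all subgroups V of G whose join with G' is G, |V ∩ gG'| denotes the number of elements of the coset gG' lying in V, and μ is the Möbius function of the subgroup lattice of G. (Equivalently, the deflation number m_{G,g}^{G'} equals 1.) -/
open scoped Classical Pointwise

/-- The Möbius function `μ(V, ⊤)` of a finite partial order with a top element,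
characterized by `μ(⊤,⊤) = 1` and `∑_{V ≤ W ≤ ⊤} μ(W,⊤) = 0` for `V < ⊤`. -/
noncomputable def topMu {α : Type*} [PartialOrder α] [OrderTop α] [Fintype α] (V : α) : ℚ :=
  if V = ⊤ then 1
  else - ∑ W : α, if _ : V < W then topMu W else 0
termination_by (Finset.univ.filter (fun W => V < W)).card
decreasing_by
  apply Finset.card_lt_card
  constructor
  · intro X hX
    simp only [Finset.mem_filter, Finset.mem_univ, true_and] at *
    exact lt_trans (by assumption) hX
  · intro hsub
    rename_i hVW
    have hW : W ∈ Finset.univ.filter (fun X => V < X) := by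
      simp only [Finset.mem_filter, Finset.mem_univ, true_and]; exact hVW
    have := hsub hW
    simp only [Finset.mem_filter, Finset.mem_univ, true_and] at this
    exact lt_irrefl W this

/-- The commutator subgroup of a finite nilpotent group consists of non-generators. -/
theorem eq_top_of_sup_commutator_eq_top {G : Type*} [Group G] [Finite G] [Group.IsNilpotent G]
    {V : Subgroup G} (hV : V ⊔ commutator G = ⊤) : V = ⊤ := by
  by_contra hne
  obtain ⟨M, hM, hVM⟩ := (eq_top_or_exists_le_coatom V).resolve_left hne
  have hN : M.Normal :=
    Subgroup.NormalizerCondition.normal_of_coatom M Group.normalizerCondition_of_isNilpotent hM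
  have hMG : M ⊔ commutator G = ⊤ := top_le_iff.mp (hV ▸ sup_le_sup_right hVM _)
  have : Nontrivial (G ⧸ M) := QuotientGroup.nontrivial_iff.mpr hM.1
  have hsurj : Function.Surjective (QuotientGroup.mk' M) := QuotientGroup.mk'_surjective M
  have hmap : commutator (G ⧸ M) = ⊤ := by
    have h := congrArg (Subgroup.map (QuotientGroup.mk' M)) hMG
    rwa [Subgroup.map_sup, QuotientGroup.map_mk'_self, bot_sup_eq, commutator_def,
      Subgroup.map_commutator, Subgroup.map_top_of_surjective _ hsurj, ← commutator_def] at h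
  exact (Group.IsSolvable.commutator_lt_top_of_nontrivial (G ⧸ M)).ne hmap

/-- For a finite `p`-group `G` and `g ∈ G`, the deflation number
`m_{G,g}^{G'} = (1/|G'|) · ∑_{V ⊔ G' = G} |V ∩ gG'| · μ(V, G)` equals `1`. -/
theorem deflation_number_at_commutator_eq_one
    {p : ℕ} (hp : p.Prime) (G : Type*) [Group G] [Fintype G]
    (hG : IsPGroup p G) (g : G) :
    (1 / (Nat.card (commutator G) : ℚ)) *
      ∑ V ∈ Finset.univ.filter (fun V : Subgroup G => V ⊔ commutator G = ⊤),
        (Nat.card ((V : Set G) ∩ g • (commutator G : Set G) : Set G) : ℚ) * topMu V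
      = 1 := by
  have : Fact p.Prime := ⟨hp⟩
  have : Group.IsNilpotent G := hG.isNilpotent
  have hfilter : Finset.univ.filter (fun V : Subgroup G => V ⊔ commutator G = ⊤) = {⊤} := by
    ext V
    simp only [Finset.mem_filter, Finset.mem_univ, true_and, Finset.mem_singleton]
    exact ⟨eq_top_of_sup_commutator_eq_top, fun h => by rw [h, top_sup_eq]⟩
  have hcard : Nat.card (g • (commutator G : Set G) : Set G) = Nat.card (commutator G) :=
    Set.natCard_smul_set g _
  have hpos : (Nat.card (commutator G) : ℚ) ≠ 0 := Nat.cast_ne_zero.mpr Nat.card_pos.ne'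
  rw [hfilter, Finset.sum_singleton, Subgroup.coe_top, Set.univ_inter, hcard, topMu, if_pos rfl,
    mul_one, one_div_mul_cancel hpos]
end

section
/- Let p be a prime, G a finite abelian p-group, N a nontrivial subgroup of G, and g ∈ G. Let Φ = Φ(G) be the Frattini subgroup of G and π : G → G/Φ the quotient homomorphism. Then m_{G,g}^N = (1/|N ∩ Φ|) · m_{G/Φ, π(g)}^{π(N)}, where π(N) denotes the image of N in G/Φ. -/
open scoped Classical

/-- For a finite abelian group `G`, a subgroup `N ≤ G` and `g ∈ G`, the deflation number
`m_{G,g}^N = (1/|N|) · ∑_{V ⊔ N = G, g ∈ V} μ(V, G)`. -/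
noncomputable def deflationNumber {G : Type*} [CommGroup G] [Fintype G]
    (N : Subgroup G) (g : G) : ℚ :=
  (1 / (Nat.card N : ℚ)) *
    ∑ V ∈ Finset.univ.filter (fun V : Subgroup G => V ⊔ N = ⊤ ∧ g ∈ V), topMu V

theorem topMu_of_ne_top {α : Type*} [PartialOrder α] [OrderTop α] [Fintype α] {a : α}
    (ha : a ≠ ⊤) : topMu a = -∑ b : α with a < b, topMu b := by
  rw [topMu, if_neg ha, Finset.sum_filter]
  simp only [dite_eq_ite]

theorem sum_topMu_of_ne_top {α : Type*} [PartialOrder α] [OrderTop α] [Fintype α] {a : α}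
    (ha : a ≠ ⊤) : ∑ b : α with a ≤ b, topMu b = 0 := by
  have h : Finset.univ.filter (fun b => a ≤ b) =
      insert a (Finset.univ.filter (fun b => a < b)) := by
    ext b
    simp [le_iff_eq_or_lt, eq_comm]
  rw [h, Finset.sum_insert (by simp), topMu_of_ne_top ha, neg_add_cancel]

/-- `μ(a, ⊤)` vanishes unless `a` lies above every non-generating element. -/
theorem topMu_eq_zero_of_not_le {α : Type*} [Lattice α] [OrderTop α] [Fintype α] {r : α}
    (hr : ∀ a : α, a ⊔ r = ⊤ → a = ⊤) (a : α) (ha : ¬ r ≤ a) : topMu a = 0 := by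
  induction a using WellFoundedGT.induction with
  | ind a ih =>
    have ha' : a ≠ ⊤ := fun h => ha (h ▸ le_top)
    have hsub : Finset.univ.filter (fun b => a ⊔ r ≤ b) ⊆
        Finset.univ.filter (fun b => a < b) := by
      intro b hb
      simp only [Finset.mem_filter, Finset.mem_univ, true_and] at hb ⊢
      exact (left_lt_sup.2 ha).trans_le hb
    rw [topMu_of_ne_top ha', ← Finset.sum_subset hsub, sum_topMu_of_ne_top (mt (hr a) ha'),
      neg_zero]
    intro b hb hb'
    simp only [Finset.mem_filter, Finset.mem_univ, true_and, sup_le_iff, not_and] at hb hb'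
    exact ih b hb (hb' hb.le)

/-- `μ(·, ⊤)` is preserved by an order embedding onto an upper set. -/
theorem topMu_orderEmbedding {α β : Type*} [PartialOrder α] [OrderTop α] [Fintype α]
    [PartialOrder β] [OrderTop β] [Fintype β] (f : α ↪o β)
    (hf : ∀ a b, f a ≤ b → ∃ c, f c = b) (a : α) : topMu (f a) = topMu a := by
  have htop : f ⊤ = ⊤ := by
    obtain ⟨c, hc⟩ := hf ⊤ ⊤ le_top
    exact top_le_iff.1 (hc ▸ f.monotone le_top)
  induction a using WellFoundedGT.induction with
  | ind a ih =>
    by_cases ha : a = ⊤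
    · subst ha
      rw [htop, topMu, topMu, if_pos rfl, if_pos rfl]
    · rw [topMu_of_ne_top ha, topMu_of_ne_top (htop ▸ f.injective.ne ha), neg_inj]
      symm
      refine Finset.sum_nbij f (by simp) f.injective.injOn ?_ ?_
      · intro b hb
        simp only [Finset.coe_filter, Finset.mem_univ, true_and, Set.mem_ofPred_eq] at hb
        obtain ⟨c, rfl⟩ := hf a b hb.le
        exact ⟨c, by simpa using hb, rfl⟩
      · intro b hb
        exact (ih b (by simpa using hb)).symm

theorem Subgroup.card_map_mul_card_inf_ker {G H : Type*} [Group G] [Group H] (f : G →* H)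
    (N : Subgroup G) : Nat.card (N.map f) * Nat.card ↥(N ⊓ f.ker) = Nat.card N := by
  rw [← Subgroup.relIndex_ker, ← Subgroup.relIndex_bot_left (N ⊓ f.ker),
    ← Subgroup.relIndex_bot_left N, mul_comm, ← Subgroup.inf_relIndex_left N f.ker]
  exact Subgroup.relIndex_mul_relIndex _ _ _ bot_le inf_le_left

/-- For a finite abelian `p`-group `G`, a nontrivial subgroup `N`, and `g ∈ G`,
`m_{G,g}^N = (1/|N ∩ Φ(G)|) · m_{G/Φ(G), gΦ(G)}^{NΦ(G)/Φ(G)}`. -/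
theorem deflation_number_frattini_quotient
    {p : ℕ} (hp : p.Prime) (G : Type*) [CommGroup G] [Fintype G]
    (hG : IsPGroup p G) (N : Subgroup G) (hN : N ≠ ⊥) (g : G) :
    deflationNumber N g =
      (1 / (Nat.card ↥(N ⊓ frattini G) : ℚ)) *
        deflationNumber (N.map (QuotientGroup.mk' (frattini G)))
          (QuotientGroup.mk' (frattini G) g) := by
  set π := QuotientGroup.mk' (frattini G)
  have hsurj : Function.Surjective π := QuotientGroup.mk'_surjective _
  have hker : π.ker = frattini G := QuotientGroup.ker_mk' _
  have hsum : ∑ V : Subgroup G with V ⊔ N = ⊤ ∧ g ∈ V, topMu V =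
      ∑ W : Subgroup (G ⧸ frattini G) with W ⊔ N.map π = ⊤ ∧ π g ∈ W, topMu W := by
    have hcomap : ∀ V : Subgroup G, frattini G ≤ V → (V.map π).comap π = V := fun V hV => by
      rw [Subgroup.comap_map_eq, hker, sup_eq_left.2 hV]
    let f : Subgroup (G ⧸ frattini G) ↪o Subgroup G :=
      OrderEmbedding.ofMapLEIff (Subgroup.comap π)
        fun _ _ => Subgroup.comap_le_comap_of_surjective hsurj
    have hle : ∀ W : Subgroup (G ⧸ frattini G), frattini G ≤ W.comap π := fun W =>
      hker.symm.trans_le (Subgroup.ker_le_comap π W)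
    have hgen : ∀ W : Subgroup (G ⧸ frattini G),
        W.comap π ⊔ N = ⊤ ↔ W ⊔ N.map π = ⊤ := fun W => by
      rw [← (Subgroup.comap_injective hsurj).eq_iff, Subgroup.comap_top,
        ← Subgroup.map_comap_eq_self_of_surjective hsurj W, ← Subgroup.map_sup,
        Subgroup.map_comap_eq_self_of_surjective hsurj W,
        hcomap _ ((hle W).trans le_sup_left)]
    symm
    refine Finset.sum_of_injOn f f.injective.injOn ?_ ?_ ?_
    · intro W hW
      simp only [Finset.coe_filter, Finset.mem_univ, true_and, Set.mem_ofPred_eq] at hW ⊢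
      exact ⟨(hgen W).2 hW.1, hW.2⟩
    · intro V hV hV'
      refine topMu_eq_zero_of_not_le (fun _ => frattini_nongenerating) V fun h => hV' ?_
      simp only [Finset.mem_filter, Finset.mem_univ, true_and] at hV
      refine ⟨V.map π, ?_, hcomap V h⟩
      simp only [Finset.coe_filter, Finset.mem_univ, true_and, Set.mem_ofPred_eq]
      exact ⟨(hgen _).1 ((hcomap V h).symm ▸ hV.1), Subgroup.mem_map_of_mem π hV.2⟩
    · intro W _
      exact (topMu_orderEmbedding f (fun W V h => ⟨V.map π, hcomap V ((hle W).trans h)⟩) W).symm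
  have hcard := Subgroup.card_map_mul_card_inf_ker π N
  rw [hker] at hcard
  rw [deflationNumber, deflationNumber, hsum, ← hcard, Nat.cast_mul, ← mul_assoc,
    one_div_mul_one_div, mul_comm (Nat.card (N.map π) : ℚ)]
end

section
/- Let p be a prime, k ≥ 1, and G a finite abelian group of order p^k in which every element x satisfies x^p = 1 (i.e., G is elementary abelian of rank k). Let T ≤ G be a subgroup of order p and g ∈ G. Then m_{G,g}^T = (1 − p^{k−1})/p if g = 1; m_{G,g}^T = 1/p if g ∈ T and g ≠ 1; and m_{G,g}^T = (1 − p^{k−2})/p if g ∉ T. -/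
open scoped Classical

section TopMu

variable {α : Type*} [PartialOrder α] [OrderTop α] [Fintype α]

theorem topMu_top : topMu (⊤ : α) = 1 := by
  rw [topMu, if_pos rfl]

theorem topMu_of_isCoatom {V : α} (hV : IsCoatom V) : topMu V = -1 := by
  rw [topMu, if_neg hV.1, Finset.sum_eq_single (⊤ : α)]
  · rw [dif_pos hV.lt_top, topMu_top]
  · intro W _ hW
    exact dif_neg fun h => hW (hV.2 W h)
  · simp

end TopMu

theorem Subgroup.isCoatom_of_sup_eq_top {G : Type*} [CommGroup G] {V T : Subgroup G}
    (hT : (Nat.card T).Prime) (hsup : V ⊔ T = ⊤) (hV : V ≠ ⊤) : IsCoatom V := by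
  have hle : ¬ T ≤ V := fun h => hV (by rwa [sup_eq_left.2 h] at hsup)
  have hinf : V ⊓ T ⋖ T := by
    refine ⟨lt_of_le_of_ne inf_le_right fun h => hle (inf_eq_right.1 h), fun W h1 h2 => ?_⟩
    have : Fact (Nat.card T).Prime := ⟨hT⟩
    rcases (W.subgroupOf T).eq_bot_or_eq_top_of_prime_card with h | h
    · rw [Subgroup.subgroupOf_eq_bot, disjoint_iff, inf_eq_left.2 h2.le] at h
      exact not_lt_bot (h ▸ h1)
    · exact h2.not_ge (Subgroup.subgroupOf_eq_top.1 h)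
  rw [← covBy_top_iff, ← hsup]
  exact covBy_sup_of_inf_covBy_right hinf

theorem LinearMap.card_fiber_mul_card {R M N : Type*} [Ring R] [AddCommGroup M] [AddCommGroup N]
    [Module R M] [Module R N] (L : M →ₗ[R] N)
    (hL : Function.Surjective L) (y : N) :
    Nat.card {x // L x = y} * Nat.card N = Nat.card M := by
  obtain ⟨x₀, rfl⟩ := hL y
  have e : {x // L x = L x₀} ≃ L.toAddMonoidHom.ker :=
    (Equiv.subRight x₀).subtypeEquiv fun x => by
      simp [AddMonoidHom.mem_ker, sub_eq_zero]
  rw [Nat.card_congr e, ← Nat.card_congr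
    (QuotientAddGroup.quotientKerEquivOfSurjective L.toAddMonoidHom hL).toEquiv, mul_comm]
  exact (AddSubgroup.card_eq_card_quotient_mul_card_addSubgroup _).symm

/-- Kernel of a linear functional on `Additive G`, as a subgroup of `G`. -/
def functionalKer {R G : Type*} [Ring R] [CommGroup G] [Module R (Additive G)]
    (f : Module.Dual R (Additive G)) : Subgroup G :=
  Subgroup.toAddSubgroup.symm (LinearMap.ker f).toAddSubgroup

theorem mem_functionalKer {R G : Type*} [Ring R] [CommGroup G] [Module R (Additive G)]
    (f : Module.Dual R (Additive G)) (x : G) : x ∈ functionalKer f ↔ f (.ofMul x) = 0 :=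
  Iff.rfl

section ElementaryAbelian

variable {p : ℕ} [Fact p.Prime] {G : Type*} [CommGroup G] [Module (ZMod p) (Additive G)]

theorem exists_functional_of_sup_zpowers_eq_top {V : Subgroup G} {t : G}
    (hsup : V ⊔ Subgroup.zpowers t = ⊤) (hV : V ≠ ⊤) :
    ∃ f : Module.Dual (ZMod p) (Additive G), f (.ofMul t) = 1 ∧ functionalKer f = V := by
  have ht : t ∉ V := fun h => hV (by
    rwa [sup_eq_left.2 ((Subgroup.zpowers_le).2 h)] at hsup)
  obtain ⟨f, hf, hle⟩ := Submodule.exists_le_ker_of_notMem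
    (p := AddSubgroup.toZModSubmodule p (Subgroup.toAddSubgroup V)) (v := Additive.ofMul t) ht
  have hker : ∀ v ∈ V, f (.ofMul v) = 0 := fun v hv => hle hv
  refine ⟨(f (.ofMul t))⁻¹ • f, by simp [hf], ?_⟩
  ext x
  rw [mem_functionalKer]
  simp only [LinearMap.smul_apply, smul_eq_mul, mul_eq_zero, inv_eq_zero, hf, false_or]
  refine ⟨fun hx => ?_, hker x⟩
  obtain ⟨v, hv, z, ⟨n, rfl⟩, rfl⟩ := Subgroup.mem_sup.1 (hsup ▸ Subgroup.mem_top x)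
  have hn : (n : ZMod p) = 0 := by
    simpa [hker v hv, hf] using hx
  have hz : t ^ n = 1 := by
    have : (n : ZMod p) • Additive.ofMul t = 0 := by rw [hn, zero_smul]
    rw [Int.cast_smul_eq_zsmul] at this
    exact this
  simpa [hz] using hv

theorem functionalKer_sup_zpowers {t : G} {f : Module.Dual (ZMod p) (Additive G)}
    (hf : f (.ofMul t) = 1) : functionalKer f ⊔ Subgroup.zpowers t = ⊤ := by
  refine (Subgroup.eq_top_iff' _).2 fun x => ?_
  obtain ⟨n, hn⟩ := ZMod.intCast_surjective (f (.ofMul x))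
  refine Subgroup.mem_sup.2 ⟨x * (t ^ n)⁻¹, ?_, t ^ n, ⟨n, rfl⟩, by simp⟩
  rw [mem_functionalKer]
  simp [hf, hn]

theorem functionalKer_injOn (t : G) :
    Set.InjOn functionalKer {f : Module.Dual (ZMod p) (Additive G) | f (.ofMul t) = 1} := by
  intro f hf f' hf' h
  ext x
  have hx : x.toMul * ((f x • Additive.ofMul t).toMul)⁻¹ ∈ functionalKer f := by
    rw [mem_functionalKer]
    simp [show f (.ofMul t) = 1 from hf]
  rw [h, mem_functionalKer] at hx
  have := hx
  simp [show f' (.ofMul t) = 1 from hf'] at this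
  linear_combination -this

variable [Fintype G]

theorem deflationNumber_zpowers {t : G} (ht : orderOf t = p) (g : G) :
    deflationNumber (Subgroup.zpowers t) g = (1 - (Nat.card
      {f : Module.Dual (ZMod p) (Additive G) //
        f (.ofMul t) = 1 ∧ f (.ofMul g) = 0} : ℚ)) / p := by
  have hT : Nat.card (Subgroup.zpowers t) = p := by rw [Nat.card_zpowers, ht]
  set S := Finset.univ.filter
    (fun V : Subgroup G => V ⊔ Subgroup.zpowers t = ⊤ ∧ g ∈ V) with hS
  have htop : (⊤ : Subgroup G) ∈ S := by simp [hS]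
  have hmu : ∀ V ∈ S.erase ⊤, topMu V = -1 := by
    intro V hV
    rw [Finset.mem_erase, hS, Finset.mem_filter] at hV
    exact topMu_of_isCoatom (Subgroup.isCoatom_of_sup_eq_top (hT ▸ Fact.out) hV.2.2.1 hV.1)
  have hcard : Nat.card {f : Module.Dual (ZMod p) (Additive G) //
      f (.ofMul t) = 1 ∧ f (.ofMul g) = 0} = (S.erase ⊤).card := by
    rw [← Nat.card_eq_finsetCard]
    refine Nat.card_eq_of_bijective (fun f => ⟨functionalKer f.1, ?_⟩) ⟨?_, ?_⟩
    · rw [Finset.mem_erase, hS, Finset.mem_filter]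
      refine ⟨fun h => ?_, Finset.mem_univ _, functionalKer_sup_zpowers f.2.1, f.2.2⟩
      have : t ∈ functionalKer f.1 := h ▸ Subgroup.mem_top t
      rw [mem_functionalKer, f.2.1] at this
      exact one_ne_zero this
    · intro f f' h
      exact Subtype.ext (functionalKer_injOn t f.2.1 f'.2.1 (congrArg Subtype.val h))
    · rintro ⟨V, hV⟩
      have hV' := hV
      rw [Finset.mem_erase, hS, Finset.mem_filter] at hV'
      obtain ⟨f, hf, rfl⟩ := exists_functional_of_sup_zpowers_eq_top (p := p) hV'.2.2.1 hV'.1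
      exact ⟨⟨f, hf, hV'.2.2.2⟩, rfl⟩
  rw [deflationNumber, ← hS, ← Finset.add_sum_erase S _ htop, Finset.sum_congr rfl hmu, topMu_top,
    Finset.sum_const, hcard, hT]
  simp
  ring

end ElementaryAbelian

theorem exists_dual_eq_one_of_notMem {K V : Type*} [Field K] [AddCommGroup V] [Module K V]
    {W : Submodule K V} {v : V} (hv : v ∉ W) :
    ∃ f : Module.Dual K V, f v = 1 ∧ ∀ w ∈ W, f w = 0 := by
  obtain ⟨f, hf, hle⟩ := Submodule.exists_le_ker_of_notMem hv
  exact ⟨(f v)⁻¹ • f, by simp [hf], fun w hw => by simp [LinearMap.mem_ker.1 (hle hw)]⟩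

theorem card_dual_eval_eq_one {K V : Type*} [Field K] [AddCommGroup V] [Module K V]
    {v : V} (hv : v ≠ 0) :
    Nat.card {f : Module.Dual K V // f v = 1} * Nat.card K = Nat.card (Module.Dual K V) := by
  refine (LinearMap.applyₗ v : Module.Dual K V →ₗ[K] K).card_fiber_mul_card (fun a => ?_) 1
  obtain ⟨f, hf, -⟩ := exists_dual_eq_one_of_notMem (W := (⊥ : Submodule K V)) (by simpa using hv)
  exact ⟨a • f, by simp [hf]⟩

theorem card_dual_eval_eq_one_eval_eq_zero {K V : Type*} [Field K] [AddCommGroup V] [Module K V]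
    {v w : V} (hv : v ≠ 0) (hw : w ∉ Submodule.span K {v}) :
    Nat.card {f : Module.Dual K V // f v = 1 ∧ f w = 0} * Nat.card K ^ 2 =
      Nat.card (Module.Dual K V) := by
  obtain ⟨f, hf, hf0⟩ := exists_dual_eq_one_of_notMem hw
  obtain ⟨h, hh, -⟩ := exists_dual_eq_one_of_notMem (W := (⊥ : Submodule K V)) (by simpa using hv)
  have hfv := hf0 v (Submodule.mem_span_singleton_self v)
  let L : Module.Dual K V →ₗ[K] K × K := (LinearMap.applyₗ v).prod (LinearMap.applyₗ w)
  have hL := L.card_fiber_mul_card (fun a => ⟨a.1 • h + (a.2 - a.1 * h w) • f, by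
    ext <;> simp [L, hf, hh, hfv]⟩) (1, 0)
  rw [← hL, Nat.card_prod, sq]
  simp [L, Prod.ext_iff]

/-- Deflation numbers for an elementary abelian `p`-group of rank `k` at a subgroup of
order `p`. -/
theorem deflation_number_elementary_abelian
    {p k : ℕ} (hp : p.Prime) (hk : 1 ≤ k) (G : Type*) [CommGroup G] [Fintype G]
    (hcard : Nat.card G = p ^ k) (hexp : ∀ x : G, x ^ p = 1)
    (T : Subgroup G) (hT : Nat.card T = p) (g : G) :
    (g = 1 → deflationNumber T g = (1 - (p : ℚ) ^ (k - 1)) / p) ∧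
    (g ≠ 1 → g ∈ T → deflationNumber T g = 1 / p) ∧
    (g ∉ T → deflationNumber T g = (1 - (p : ℚ) ^ (k - 2)) / p) := by
  have : Fact p.Prime := ⟨hp⟩
  obtain ⟨_⟩ : Nonempty (Module (ZMod p) (Additive G)) :=
    ⟨AddCommGroup.zmodModule fun x => hexp x.toMul⟩
  obtain ⟨t, rfl⟩ : ∃ t, Subgroup.zpowers t = T := by
    have : IsCyclic T := isCyclic_of_prime_card hT
    exact (Subgroup.isCyclic_iff_exists_zpowers_eq_top T).1 this
  have ht : orderOf t = p := by rw [← hT, Nat.card_zpowers]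
  have ht0 : Additive.ofMul t ≠ 0 := fun h => hp.one_lt.ne' (by
    rw [← ht, orderOf_eq_one_iff]; exact h)
  have hdual : Nat.card (Module.Dual (ZMod p) (Additive G)) = p ^ k := by
    have : Module.Finite (ZMod p) (Additive G) := Module.Finite.of_finite
    rw [Module.natCard_eq_pow_finrank (K := ZMod p), Subspace.dual_finrank_eq,
      ← Module.natCard_eq_pow_finrank (K := ZMod p)]
    exact hcard
  have hspan : ∀ x : G, Additive.ofMul x ∈ Submodule.span (ZMod p) {Additive.ofMul t} →
      x ∈ Subgroup.zpowers t := by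
    intro x hx
    obtain ⟨a, ha⟩ := Submodule.mem_span_singleton.1 hx
    obtain ⟨n, rfl⟩ := ZMod.intCast_surjective a
    rw [Int.cast_smul_eq_zsmul] at ha
    exact ⟨n, ha⟩
  rw [deflationNumber_zpowers ht g]
  refine ⟨?_, fun hg hgT => ?_, fun hgT => ?_⟩
  · rintro rfl
    have h := card_dual_eval_eq_one (K := ZMod p) ht0
    rw [hdual, Nat.card_zmod] at h
    obtain ⟨m, rfl⟩ := Nat.exists_eq_add_of_le' hk
    have h' := Nat.eq_of_mul_eq_mul_right hp.pos (h.trans (pow_succ p m))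
    simp [h']
  · obtain ⟨n, rfl⟩ := hgT
    have hempty : IsEmpty {f : Module.Dual (ZMod p) (Additive G) //
        f (.ofMul t) = 1 ∧ f (.ofMul (t ^ n)) = 0} := by
      refine ⟨fun f => hg ?_⟩
      have hn : (n : ZMod p) = 0 := by simpa [f.2.1] using f.2.2
      rw [ZMod.intCast_zmod_eq_zero_iff_dvd, ← ht] at hn
      exact orderOf_dvd_iff_zpow_eq_one.1 hn
    simp only [Nat.card_of_isEmpty, Nat.cast_zero, sub_zero]
  · have h := card_dual_eval_eq_one_eval_eq_zero (K := ZMod p) ht0 (mt (hspan g) hgT)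
    rw [hdual, Nat.card_zmod] at h
    have hk2 : 2 ≤ k := (Nat.pow_dvd_pow_iff_le_right hp.one_lt).1 ⟨_, (mul_comm _ _).trans h |>.symm⟩
    obtain ⟨m, rfl⟩ := Nat.exists_eq_add_of_le' hk2
    have h' := Nat.eq_of_mul_eq_mul_right (pow_pos hp.pos 2) (h.trans (pow_add p m 2))
    simp [h']
end

section
/- Let p be a prime and G a finite abelian group (written multiplicatively) containing at least two distinct subgroups of order p. Suppose α : G → ℂ is a function such that for every element t ∈ G of order p and every g ∈ G one has ∑_{i=0}^{p−1} α(g·t^i) = 0. Then α is identically zero. -/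
/-- If a finite abelian group `G` has at least two distinct subgroups of order `p`, and
`α : G → ℂ` satisfies `∑_{i=0}^{p-1} α(g·tⁱ) = 0` for every element `t` of order `p` and
every `g ∈ G`, then `α = 0`. -/
theorem eq_zero_of_sum_over_order_p_translates_eq_zero
    {p : ℕ} (hp : p.Prime) (G : Type*) [CommGroup G] [Finite G]
    (H K : Subgroup G) (hH : Nat.card H = p) (hK : Nat.card K = p) (hHK : H ≠ K)
    (α : G → ℂ)
    (hα : ∀ t : G, orderOf t = p → ∀ g : G, ∑ i ∈ Finset.range p, α (g * t ^ i) = 0) :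
    ∀ g : G, α g = 0 := by
  intro g
  have : Fact p.Prime := ⟨hp⟩
  have pow_eq_one : ∀ (L : Subgroup G), Nat.card L = p → ∀ x ∈ L, x ^ p = 1 := by
    intro L hL x hx
    have h : (⟨x, hx⟩ : L) ^ p = 1 := hL ▸ pow_card_eq_one'
    simpa using congrArg Subtype.val h
  have hle : ¬ H ≤ K := fun h => hHK (Subgroup.eq_of_le_of_card_ge h (by rw [hH, hK]))
  obtain ⟨s, hsH, hsK⟩ := SetLike.not_le_iff_exists.mp hle
  have hKbot : K ≠ ⊥ := by
    rintro rfl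
    exact hp.one_lt.ne (by simpa using hK)
  obtain ⟨t, htK, ht1⟩ := K.bot_or_exists_ne_one.resolve_left hKbot
  have ht : orderOf t = p := orderOf_eq_prime (pow_eq_one K hK t htK) ht1
  have hst : ∀ j : ℕ, orderOf (s * t ^ j) = p := by
    intro j
    refine orderOf_eq_prime ?_ fun h => hsK ?_
    · rw [mul_pow, pow_eq_one H hH s hsH, pow_eq_one K hK _ (pow_mem htK j), one_mul]
    · rw [eq_inv_of_mul_eq_one_left h]
      exact inv_mem (pow_mem htK j)
  have hsum : ∑ i ∈ Finset.range p, ∑ j ∈ Finset.range p, α (g * (s * t ^ j) ^ i) = 0 := by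
    rw [Finset.sum_comm]
    exact Finset.sum_eq_zero fun j _ => hα _ (hst j) g
  rw [Finset.sum_eq_single_of_mem 0 (Finset.mem_range.mpr hp.pos)] at hsum
  · simpa [hp.ne_zero] using hsum
  · intro i hi hi0
    have hti : orderOf (t ^ i) = p := by
      rw [Nat.Coprime.orderOf_pow, ht]
      rw [ht]
      exact Nat.coprime_of_lt_prime hi0 (Finset.mem_range.mp hi) hp
    rw [← hα _ hti (g * s ^ i)]
    refine Finset.sum_congr rfl fun j _ => ?_
    rw [mul_pow, ← pow_mul, ← pow_mul, mul_comm j i, mul_assoc]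
end
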